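/- arXiv:2509.17443 — 2 statements merged into one kernel-verified Lean document; each statement's English description precedes it below -/
import Mathlib

section
/- There exists a constant C > 0, depending only on C₀ and λ, such that for every horizon T > 0 and every triple (α, β, γ) ∈ 𝓔(T, λ, C₀), one has α(0) + γ(T) ≤ C (α(T) + γ(0)). -/
open MeasureTheory

/-- `f` is càdlàg on `[a, b]`: right-continuous at every point of `[a, b)` and
with a (finite) left limit at every point of `(a, b]`. -/
def CadlagOn (f : ℝ → ℝ) (a b : ℝ) : Prop :=
  (∀ t ∈ Set.Ico a b, Filter.Tendsto f (nhdsWithin t (Set.Ioi t)) (nhds (f t))) ∧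
  (∀ t ∈ Set.Ioc a b, ∃ L : ℝ, Filter.Tendsto f (nhdsWithin t (Set.Iio t)) (nhds L))

/-- The class `𝓔(T, λ, C₀)` of triples of nonnegative càdlàg integrable functions
on `[0, T]` satisfying the four structural inequalities. -/
structure MemE (T lam C₀ : ℝ) (α β γ : ℝ → ℝ) : Prop where
  cadlag_alpha : CadlagOn α 0 T
  cadlag_beta : CadlagOn β 0 T
  cadlag_gamma : CadlagOn γ 0 T
  nonneg_alpha : ∀ t ∈ Set.Icc 0 T, 0 ≤ α t
  nonneg_beta : ∀ t ∈ Set.Icc 0 T, 0 ≤ β t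
  nonneg_gamma : ∀ t ∈ Set.Icc 0 T, 0 ≤ γ t
  int_alpha : IntervalIntegrable α MeasureTheory.volume 0 T
  int_beta : IntervalIntegrable β MeasureTheory.volume 0 T
  int_gamma : IntervalIntegrable γ MeasureTheory.volume 0 T
  ineq1 : ∀ t₁ t₂, 0 ≤ t₁ → t₁ ≤ t₂ → t₂ ≤ T →
    (∫ t in t₁..t₂, β t) ≤
      C₀ * (Real.sqrt (α t₁ * γ t₁) + Real.sqrt (α t₂ * γ t₂))
  ineq2 : ∀ t₁ t₂, 0 ≤ t₁ → t₁ ≤ t₂ → t₂ ≤ T →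
    γ t₂ ≤ C₀ * Real.exp (-lam * (t₂ - t₁)) * γ t₁ + C₀ * ∫ t in t₁..t₂, β t
  ineq3 : ∀ t₁ t₂, 0 ≤ t₁ → t₁ ≤ t₂ → t₂ ≤ T →
    α t₁ ≤ C₀ * Real.exp (-lam * (t₂ - t₁)) * α t₂ + C₀ * (∫ t in t₁..t₂, β t)
      + C₀ * sSup (γ '' Set.Icc t₁ t₂)
  ineq4 : ∀ t ∈ Set.Icc 0 T, α t ≤ C₀ * β t

/-- A weighted arithmetic-geometric mean inequality. -/
lemma mul_sqrt_mul_le {a b : ℝ} (ha : 0 ≤ a) (hb : 0 ≤ b) (M : ℝ) :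
    M * Real.sqrt (a * b) ≤ a / 2 + M ^ 2 * b / 2 := by
  rw [Real.sqrt_mul ha]
  nlinarith [sq_nonneg (Real.sqrt a - M * Real.sqrt b), Real.sq_sqrt ha, Real.sq_sqrt hb]

namespace MemE

variable {T lam C₀ : ℝ} {α β γ : ℝ → ℝ}

/-- On the whole interval, `γ` is bounded by its initial value and the integral of `β`. -/
lemma gamma_le (h : MemE T lam C₀ α β γ) (hlam : 0 < lam) (hC₀ : 0 < C₀) {t : ℝ}
    (ht : t ∈ Set.Icc 0 T) : γ t ≤ C₀ * γ 0 + C₀ * ∫ s in (0)..T, β s := by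
  have hT : 0 ≤ T := ht.1.trans ht.2
  have hγ := h.nonneg_gamma 0 ⟨le_rfl, hT⟩
  have hexp : Real.exp (-lam * (t - 0)) ≤ 1 :=
    Real.exp_le_one_iff.2 (by nlinarith [ht.1])
  have hint : (∫ s in (0)..t, β s) ≤ ∫ s in (0)..T, β s := by
    refine intervalIntegral.integral_mono_interval le_rfl ht.1 ht.2 ?_ h.int_beta
    filter_upwards [ae_restrict_mem measurableSet_Ioc] with s hs
    exact h.nonneg_beta s ⟨hs.1.le, hs.2⟩
  calc γ t ≤ C₀ * Real.exp (-lam * (t - 0)) * γ 0 + C₀ * ∫ s in (0)..t, β s :=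
        h.ineq2 0 t le_rfl ht.1 ht.2
    _ ≤ C₀ * 1 * γ 0 + C₀ * ∫ s in (0)..T, β s := by gcongr
    _ = C₀ * γ 0 + C₀ * ∫ s in (0)..T, β s := by ring

/-- The initial value of `α` is bounded by `α T`, `γ 0` and the integral of `β`. -/
lemma alpha_zero_le (h : MemE T lam C₀ α β γ) (hlam : 0 < lam) (hC₀ : 0 < C₀) (hT : 0 < T) :
    α 0 ≤ C₀ * α T + C₀ * (∫ s in (0)..T, β s)
      + C₀ * (C₀ * γ 0 + C₀ * ∫ s in (0)..T, β s) := by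
  have hα := h.nonneg_alpha T ⟨hT.le, le_rfl⟩
  have hexp : Real.exp (-lam * (T - 0)) ≤ 1 := Real.exp_le_one_iff.2 (by nlinarith)
  have hsup : sSup (γ '' Set.Icc 0 T) ≤ C₀ * γ 0 + C₀ * ∫ s in (0)..T, β s := by
    refine csSup_le ((Set.nonempty_Icc.2 hT.le).image γ) ?_
    rintro _ ⟨t, ht, rfl⟩
    exact h.gamma_le hlam hC₀ ht
  calc α 0 ≤ C₀ * Real.exp (-lam * (T - 0)) * α T + C₀ * (∫ s in (0)..T, β s)
        + C₀ * sSup (γ '' Set.Icc 0 T) := h.ineq3 0 T le_rfl hT.le le_rfl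
    _ ≤ C₀ * 1 * α T + C₀ * (∫ s in (0)..T, β s)
        + C₀ * (C₀ * γ 0 + C₀ * ∫ s in (0)..T, β s) := by gcongr
    _ = _ := by rw [mul_one]

end MemE

/-- Endpoint comparison: there exists `C > 0` depending only on `C₀` and `λ` such that
for every `T > 0` and every `(α, β, γ) ∈ 𝓔(T, λ, C₀)`,
`α(0) + γ(T) ≤ C (α(T) + γ(0))`. -/
theorem endpoint_comparison (lam C₀ : ℝ) (hlam : 0 < lam) (hC₀ : 0 < C₀) :
    ∃ C : ℝ, 0 < C ∧
      ∀ T : ℝ, 0 < T → ∀ α β γ : ℝ → ℝ, MemE T lam C₀ α β γ →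
        α 0 + γ T ≤ C * (α T + γ 0) := by
  set K := 2 * C₀ + C₀ ^ 2 with hK
  refine ⟨2 * K + (K * C₀) ^ 2, by positivity, fun T hT α β γ h => ?_⟩
  have h0 : (0 : ℝ) ∈ Set.Icc 0 T := ⟨le_rfl, hT.le⟩
  have h1 : T ∈ Set.Icc 0 T := ⟨hT.le, le_rfl⟩
  have hα := h.alpha_zero_le hlam hC₀ hT
  have hγ := h.gamma_le hlam hC₀ h1
  have hβ := mul_le_mul_of_nonneg_left (h.ineq1 0 T le_rfl hT.le le_rfl)
    (by positivity : 0 ≤ K)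
  have hs0 := mul_sqrt_mul_le (h.nonneg_alpha 0 h0) (h.nonneg_gamma 0 h0) (K * C₀)
  have hs1 := mul_sqrt_mul_le (h.nonneg_gamma T h1) (h.nonneg_alpha T h1) (K * C₀)
  rw [mul_comm (γ T)] at hs1
  have hαT := h.nonneg_alpha T h1
  have hγ0 := h.nonneg_gamma 0 h0
  have hsum : α 0 + γ T ≤ K * (α T + γ 0) + K * ∫ s in (0)..T, β s := by
    have e1 : 0 ≤ (C₀ + C₀ ^ 2) * α T := by positivity
    have e2 : 0 ≤ C₀ * γ 0 := by positivity
    rw [hK]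
    linarith
  linarith
end

section
/- Self-improvement of discounted bounds for the class 𝓔(δ, λ, C₀): let δ ∈ (0, λ], τ ≥ 0 and M > 0, and suppose that for every triple (α, β, γ) ∈ 𝓔(δ, λ, C₀) with α(0) + γ(0) ≤ 1 and every t ≥ τ, one has e^{−δt}(α(t) + γ(t)) ≤ M. Then for every triple (α, β, γ) ∈ 𝓔(δ, λ, C₀) with α(0) + γ(0) ≤ 1 and every s ≥ 2τ, one has e^{−δs}(α(s) + γ(s)) ≤ M². -/
open MeasureTheory

/-- `f` is càdlàg on `[0, ∞)`: right-continuous at every `t ≥ 0` and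
with a (finite) left limit at every `t > 0`. -/
def CadlagOnIci (f : ℝ → ℝ) : Prop :=
  (∀ t : ℝ, 0 ≤ t → Filter.Tendsto f (nhdsWithin t (Set.Ioi t)) (nhds (f t))) ∧
  (∀ t : ℝ, 0 < t → ∃ L : ℝ, Filter.Tendsto f (nhdsWithin t (Set.Iio t)) (nhds L))

/-- The discounted class `𝓔(δ, λ, C₀)` of triples of nonnegative bounded càdlàg
functions on `[0, ∞)` satisfying the four structural inequalities. -/
structure MemED (δ lam C₀ : ℝ) (α β γ : ℝ → ℝ) : Prop where
  cadlag_alpha : CadlagOnIci α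
  cadlag_beta : CadlagOnIci β
  cadlag_gamma : CadlagOnIci γ
  nonneg_alpha : ∀ t : ℝ, 0 ≤ t → 0 ≤ α t
  nonneg_beta : ∀ t : ℝ, 0 ≤ t → 0 ≤ β t
  nonneg_gamma : ∀ t : ℝ, 0 ≤ t → 0 ≤ γ t
  bdd_alpha : ∃ M : ℝ, ∀ t : ℝ, 0 ≤ t → α t ≤ M
  bdd_beta : ∃ M : ℝ, ∀ t : ℝ, 0 ≤ t → β t ≤ M
  bdd_gamma : ∃ M : ℝ, ∀ t : ℝ, 0 ≤ t → γ t ≤ M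
  ineq1 : ∀ t₁ : ℝ, 0 ≤ t₁ →
    (∫ t in Set.Ioi t₁, Real.exp (-δ * t) * β t) ≤
      C₀ * Real.exp (-δ * t₁) * Real.sqrt (α t₁ * γ t₁)
  ineq2 : ∀ t₁ t₂ : ℝ, 0 ≤ t₁ → t₁ ≤ t₂ →
    γ t₂ ≤ C₀ * Real.exp (-lam * (t₂ - t₁)) * γ t₁ + C₀ * ∫ t in t₁..t₂, β t
  ineq3 : ∀ t₁ : ℝ, 0 ≤ t₁ →
    α t₁ ≤ C₀ * (∫ t in Set.Ioi t₁, Real.exp (-lam * (t - t₁)) * β t)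
      + C₀ * sSup ((fun t => Real.exp (-lam * (t - t₁)) * γ t) '' Set.Ici t₁)
  ineq4 : ∀ t : ℝ, 0 ≤ t → α t ≤ C₀ * β t

theorem CadlagOnIci.comp_add_right {f : ℝ → ℝ} (hf : CadlagOnIci f) {u : ℝ} (hu : 0 ≤ u) :
    CadlagOnIci fun t => f (t + u) := by
  have hcont (t : ℝ) : Filter.Tendsto (fun x => x + u) (nhds t) (nhds (t + u)) :=
    (continuous_add_const u).tendsto t
  refine ⟨fun t ht => (hf.1 (t + u) (by linarith)).comp ?_, fun t ht => ?_⟩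
  · exact tendsto_nhdsWithin_of_tendsto_nhds_of_eventually_within _
      ((hcont t).mono_left nhdsWithin_le_nhds)
      (eventually_nhdsWithin_of_forall fun x hx => by simpa using hx)
  · obtain ⟨L, hL⟩ := hf.2 (t + u) (by linarith)
    refine ⟨L, hL.comp ?_⟩
    exact tendsto_nhdsWithin_of_tendsto_nhds_of_eventually_within _
      ((hcont t).mono_left nhdsWithin_le_nhds)
      (eventually_nhdsWithin_of_forall fun x hx => by simpa using hx)

theorem CadlagOnIci.const_mul {f : ℝ → ℝ} (hf : CadlagOnIci f) (k : ℝ) :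
    CadlagOnIci fun t => k * f t :=
  ⟨fun t ht => (hf.1 t ht).const_mul k, fun t ht =>
    let ⟨L, hL⟩ := hf.2 t ht
    ⟨k * L, hL.const_mul k⟩⟩

theorem setIntegral_Ioi_comp_add_right (f : ℝ → ℝ) (a u : ℝ) :
    ∫ t in Set.Ioi a, f (t + u) = ∫ t in Set.Ioi (a + u), f t := by
  have h := (measurePreserving_add_right volume u).setIntegral_preimage_emb
    (measurableEmbedding_addRight u) f (Set.Ioi (a + u))
  rw [← h]
  simp

/-- The class `𝓔(δ, λ, C₀)` is invariant under forward time translations. -/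
theorem MemED.comp_add_right {δ lam C₀ : ℝ} {α β γ : ℝ → ℝ} (h : MemED δ lam C₀ α β γ)
    {u : ℝ} (hu : 0 ≤ u) :
    MemED δ lam C₀ (fun t => α (t + u)) (fun t => β (t + u)) (fun t => γ (t + u)) where
  cadlag_alpha := h.cadlag_alpha.comp_add_right hu
  cadlag_beta := h.cadlag_beta.comp_add_right hu
  cadlag_gamma := h.cadlag_gamma.comp_add_right hu
  nonneg_alpha t ht := h.nonneg_alpha _ (by linarith)
  nonneg_beta t ht := h.nonneg_beta _ (by linarith)
  nonneg_gamma t ht := h.nonneg_gamma _ (by linarith)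
  bdd_alpha := h.bdd_alpha.imp fun _ hB t ht => hB _ (by linarith)
  bdd_beta := h.bdd_beta.imp fun _ hB t ht => hB _ (by linarith)
  bdd_gamma := h.bdd_gamma.imp fun _ hB t ht => hB _ (by linarith)
  ineq1 t ht := by
    have hexp (x : ℝ) : Real.exp (δ * u) * Real.exp (-δ * (x + u)) = Real.exp (-δ * x) := by
      rw [← Real.exp_add]
      ring_nf
    have key := mul_le_mul_of_nonneg_left (h.ineq1 (t + u) (by linarith)) (Real.exp_pos (δ * u)).le
    rw [← setIntegral_Ioi_comp_add_right, ← integral_const_mul, ← mul_assoc,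
      mul_left_comm _ C₀, hexp] at key
    simpa only [← mul_assoc, hexp] using key
  ineq2 t₁ t₂ h₁ h₂ := by
    have key := h.ineq2 (t₁ + u) (t₂ + u) (by linarith) (by linarith)
    rwa [add_sub_add_right_eq_sub, ← intervalIntegral.integral_comp_add_right] at key
  ineq3 t ht := by
    have key := h.ineq3 (t + u) (by linarith)
    rw [← setIntegral_Ioi_comp_add_right, ← Set.image_add_const_Ici, Set.image_image] at key
    simpa only [add_sub_add_right_eq_sub] using key
  ineq4 t ht := h.ineq4 _ (by linarith)

/-- The class `𝓔(δ, λ, C₀)` is invariant under multiplication by nonnegative constants. -/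
theorem MemED.const_mul {δ lam C₀ : ℝ} {α β γ : ℝ → ℝ} (h : MemED δ lam C₀ α β γ)
    {k : ℝ} (hk : 0 ≤ k) :
    MemED δ lam C₀ (fun t => k * α t) (fun t => k * β t) (fun t => k * γ t) where
  cadlag_alpha := h.cadlag_alpha.const_mul k
  cadlag_beta := h.cadlag_beta.const_mul k
  cadlag_gamma := h.cadlag_gamma.const_mul k
  nonneg_alpha t ht := mul_nonneg hk (h.nonneg_alpha t ht)
  nonneg_beta t ht := mul_nonneg hk (h.nonneg_beta t ht)
  nonneg_gamma t ht := mul_nonneg hk (h.nonneg_gamma t ht)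
  bdd_alpha := let ⟨B, hB⟩ := h.bdd_alpha; ⟨k * B, fun t ht => by gcongr; exact hB t ht⟩
  bdd_beta := let ⟨B, hB⟩ := h.bdd_beta; ⟨k * B, fun t ht => by gcongr; exact hB t ht⟩
  bdd_gamma := let ⟨B, hB⟩ := h.bdd_gamma; ⟨k * B, fun t ht => by gcongr; exact hB t ht⟩
  ineq1 t ht := by
    have hsqrt : √(k * α t * (k * γ t)) = k * √(α t * γ t) := by
      rw [mul_mul_mul_comm, Real.sqrt_mul (mul_self_nonneg k), Real.sqrt_mul_self hk]
    rw [hsqrt]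
    simp only [mul_left_comm _ k, integral_const_mul]
    exact mul_le_mul_of_nonneg_left (h.ineq1 t ht) hk
  ineq2 t₁ t₂ h₁ h₂ := by
    simp only [mul_left_comm _ k, intervalIntegral.integral_const_mul, ← mul_add]
    exact mul_le_mul_of_nonneg_left (h.ineq2 t₁ t₂ h₁ h₂) hk
  ineq3 t ht := by
    have hsup : sSup ((fun x => k * (Real.exp (-lam * (x - t)) * γ x)) '' Set.Ici t) =
        k * sSup ((fun x => Real.exp (-lam * (x - t)) * γ x) '' Set.Ici t) := by
      rw [← smul_eq_mul, ← Real.sSup_smul_of_nonneg hk, ← Set.image_smul, Set.image_image]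
      rfl
    simp only [mul_left_comm _ k, integral_const_mul, hsup, ← mul_add k]
    exact mul_le_mul_of_nonneg_left (h.ineq3 t ht) hk
  ineq4 t ht := by
    rw [mul_left_comm]
    exact mul_le_mul_of_nonneg_left (h.ineq4 t ht) hk

/-- Self-improvement of discounted bounds for the class `𝓔(δ, λ, C₀)`. -/
theorem discounted_bound_self_improvement (δ lam C₀ : ℝ) (hδ0 : 0 < δ)
    (hδlam : δ ≤ lam) (hlam : 0 < lam) (hC₀ : 0 < C₀)
    (τ : ℝ) (hτ : 0 ≤ τ) (M : ℝ) (hM : 0 < M)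
    (hyp : ∀ α β γ : ℝ → ℝ, MemED δ lam C₀ α β γ → α 0 + γ 0 ≤ 1 →
      ∀ t : ℝ, τ ≤ t → Real.exp (-δ * t) * (α t + γ t) ≤ M) :
    ∀ α β γ : ℝ → ℝ, MemED δ lam C₀ α β γ → α 0 + γ 0 ≤ 1 →
      ∀ s : ℝ, 2 * τ ≤ s → Real.exp (-δ * s) * (α s + γ s) ≤ M ^ 2 := by
  intro α β γ h h0 s hs
  have hu : 0 ≤ s / 2 := by linarith
  have hfirst := hyp α β γ h h0 (s / 2) (by linarith)
  have hk : 0 ≤ Real.exp (-δ * (s / 2)) / M := by positivity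
  have hsecond := hyp _ _ _ ((h.comp_add_right hu).const_mul hk)
    (by rw [zero_add, ← mul_add, div_mul_eq_mul_div]; exact (div_le_one hM).2 hfirst)
    (s / 2) (by linarith)
  rw [add_halves, ← mul_add, div_mul_eq_mul_div, mul_div_assoc', div_le_iff₀ hM,
    ← mul_assoc, ← Real.exp_add, ← mul_add, add_halves] at hsecond
  rwa [sq]
end
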